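/- Let K be a field and t transcendental over K. Suppose s ∈ K(t) with s transcendental over K, and let A = {1, ω₁, ..., ω_{m-1}} be a K(s)-basis of K(t). If the minimal polynomial f of t over K(s) has degree h > 1, then some root β of f lying in K(t) is a K(s)-linear combination of elements of A in a way that violates the linear disjointness of K(s) and K(A) over K; in particular, if K(s) and K(A) are linearly disjoint over K then h = 1. -/

import Mathlib

open IntermediateField

/-- Let `t` be transcendental over `K` (model `K(t) = RatFunc K`,
`t = RatFunc.X`), `s ∈ K(t)` transcendental over `K` (so `[K(t) : K(s)] < ∞`), and let
`A` be a `K(s)`-linear basis of `K(t)` containing `1`.  If `K(s)` and `K(A)` are linearly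
disjoint over `K`, then the minimal polynomial of `t` over `K(s)` has degree `h = 1`. -/
theorem linearly_disjoint_implies_minpoly_degree_one
    (K : Type*) [Field K] (s : RatFunc K) (hs : Transcendental K s)
    (hfin : FiniteDimensional (adjoin K {s}) (RatFunc K))
    (A : Set (RatFunc K)) (h1 : (1 : RatFunc K) ∈ A)
    (hspan : Submodule.span (adjoin K {s}) A = ⊤)
    (hli : LinearIndependent (adjoin K {s}) ((↑) : A → RatFunc K))
    (hld : (adjoin K {s}).LinearDisjoint (adjoin K A)) :
    (minpoly (adjoin K {s}) (RatFunc.X : RatFunc K)).natDegree = 1 := by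
  classical
  have hE : adjoin K A = ⊥ := by
    by_contra hne
    have hX := RatFunc.IntermediateField.isAlgebraic_X hne
    obtain ⟨x, hx, hxb⟩ : ∃ x ∈ adjoin K A, x ∉ (⊥ : IntermediateField K (RatFunc K)) := by
      by_contra! h
      exact hne (le_bot_iff.mp h)
    have hxC : ¬∃ c, x = RatFunc.C c := by
      rintro ⟨c, rfl⟩
      exact hxb ⟨c, rfl⟩
    have halg := RatFunc.isAlgebraic_adjoin_simple_X' x hxC
    have hsalg : IsAlgebraic (adjoin K A) s :=
      IsAlgebraic.tower_top_of_subalgebra_le (adjoin_simple_le_iff.mpr hx) (halg.isAlgebraic s)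
    let g : adjoin K {s} := ⟨s, mem_adjoin_simple_self K s⟩
    have hg : LinearIndependent K (fun n : ℕ => g ^ n) := by
      rw [linearIndependent_iff']
      intro t c hc i hi
      have hc' : ∑ i ∈ t, c i • s ^ i = 0 := by
        simpa [g] using congrArg (algebraMap (adjoin K {s}) (RatFunc K)) hc
      have := (transcendental_iff.mp hs) (∑ i ∈ t, Polynomial.monomial i (c i))
        (by simpa [Polynomial.aeval_monomial, Algebra.smul_def] using hc')
      have h := congrArg (fun q => Polynomial.coeff q i) this
      simpa [Polynomial.finsetSum_coeff, Polynomial.coeff_monomial, hi] using h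
    have h2 := hld.linearIndependent_left hg
    obtain ⟨p, hp0, hp⟩ := hsalg
    apply hp0
    rw [Polynomial.aeval_eq_sum_range] at hp
    have h3 := linearIndependent_iff'.mp h2 (Finset.range (p.natDegree + 1)) (fun i => p.coeff i)
      (by simpa [g] using hp)
    ext i
    by_cases hi : i < p.natDegree + 1
    · simp [h3 i (Finset.mem_range.mpr hi)]
    · rw [Polynomial.coeff_eq_zero_of_natDegree_lt (by omega)]; simp
  have hA : ∀ a ∈ A, a ∈ Submodule.span (adjoin K {s}) ({1} : Set (RatFunc K)) := by
    intro a ha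
    have : a ∈ adjoin K A := subset_adjoin K A ha
    rw [hE] at this
    obtain ⟨c, rfl⟩ := IntermediateField.mem_bot.mp this
    rw [Submodule.mem_span_singleton]
    exact ⟨algebraMap K _ c, by rw [Algebra.smul_def, mul_one]; rfl⟩
  have hX : (RatFunc.X : RatFunc K) ∈ Submodule.span (adjoin K {s}) ({1} : Set (RatFunc K)) :=
    Submodule.span_le.mpr hA (hspan ▸ Submodule.mem_top)
  obtain ⟨c, hc⟩ := Submodule.mem_span_singleton.mp hX
  rw [Algebra.smul_def, mul_one] at hc
  rw [← hc, minpoly.eq_X_sub_C]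
  exact Polynomial.natDegree_X_sub_C c
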